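/- arXiv:2512.14638 — 2 statements merged into one kernel-verified Lean document; each statement's English description precedes it below -/
import Mathlib

section
/- Let k ≥ 6 and m ≥ 2 be integers. For each j ≥ 1 let R_j denote the least positive integer N such that every j-coloring of B_N contains a monochromatic induced copy of B_m (such N exists). Then R_k ≤ (R_{⌊k/2⌋} − 2)·R_{⌈k/2⌉} + R_{⌊k/2⌋}. -/
/-- `j`-colorings of `B_N` have a monochromatic strong copy of `B_m`. -/
def HasMono (m j N : ℕ) : Prop :=
  ∀ χ : Finset (Fin N) → Fin j,
    ∃ f : Finset (Fin m) → Finset (Fin N),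
      (∀ S T : Finset (Fin m), S ⊆ T ↔ f S ⊆ f T) ∧
      ∃ c : Fin j, ∀ S, χ (f S) = c

theorem hasMono_lower (m j N : ℕ) (hm : 2 ≤ m) (h : HasMono m j N) : 2 * j ≤ N := by
  by_contra hlt
  push Not at hlt
  have hc : ∀ S : Finset (Fin N), S.card / 2 < j := by
    intro S
    have := S.card_le_univ
    rw [Fintype.card_fin] at this
    omega
  obtain ⟨f, hf, c, hfc⟩ := h (fun S => ⟨S.card / 2, hc S⟩)
  have mono : ∀ S T : Finset (Fin m), S ⊂ T → (f S).card < (f T).card := by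
    intro S T hST
    apply Finset.card_lt_card
    rw [Finset.ssubset_def] at hST ⊢
    exact ⟨(hf _ _).1 hST.1, fun h => hST.2 ((hf _ _).2 h)⟩
  obtain ⟨u, v, huv⟩ : ∃ u v : Fin m, u ≠ v :=
    ⟨⟨0, by omega⟩, ⟨1, by omega⟩, by simp⟩
  have h1 := mono ∅ {u} (by simp [Finset.ssubset_def])
  have h2 := mono {u} {u, v} (by
    rw [Finset.ssubset_def]
    refine ⟨by simp, fun h => huv ?_⟩
    have : v ∈ ({u} : Finset (Fin m)) := h (by simp)
    exact (Finset.mem_singleton.1 this).symm)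
  have e1 := congrArg Fin.val ((hfc ∅).trans (hfc {u, v}).symm)
  simp only at e1
  omega

theorem hasMono_transfer {m k a r N : ℕ} (h : HasMono m a r) (χ : Finset (Fin N) → Fin k)
    (A : Finset (Fin k)) (hA : A.card = a) (g : Finset (Fin r) → Finset (Fin N))
    (hg : ∀ S T, S ⊆ T ↔ g S ⊆ g T) (hgA : ∀ S, χ (g S) ∈ A) :
    ∃ f : Finset (Fin m) → Finset (Fin N),
      (∀ S T : Finset (Fin m), S ⊆ T ↔ f S ⊆ f T) ∧
      ∃ c : Fin k, ∀ S, χ (f S) = c := by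
  obtain ⟨f, hf, c, hfc⟩ := h (fun S => A.equivFinOfCardEq hA ⟨χ (g S), hgA S⟩)
  refine ⟨fun S => g (f S), fun S T => (hf S T).trans (hg _ _),
    ((A.equivFinOfCardEq hA).symm c : A), fun S => ?_⟩
  rw [← hfc S, Equiv.symm_apply_apply]

open Classical in
/-- Blob embedding. -/
noncomputable def blob {r s t N : ℕ} (e : Fin N ≃ Fin r ⊕ (Fin t × Fin s)) (S : Finset (Fin r))
    (T : Finset (Fin s)) : Finset (Fin N) :=
  Finset.univ.filter (fun x => Sum.elim (fun i => i ∈ S)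
    (fun p => p.1.val + 2 < S.card ∨ (p.1.val + 2 = S.card ∧ p.2 ∈ T)) (e x))

theorem blob_subset {r s t N : ℕ} (e : Fin N ≃ Fin r ⊕ (Fin t × Fin s)) (S S' : Finset (Fin r))
    (T T' : Finset (Fin s)) : blob e S T ⊆ blob e S' T' ↔ S ⊆ S' ∧
      ∀ p : Fin t × Fin s, (p.1.val + 2 < S.card ∨ (p.1.val + 2 = S.card ∧ p.2 ∈ T)) →
        (p.1.val + 2 < S'.card ∨ (p.1.val + 2 = S'.card ∧ p.2 ∈ T')) := by
  constructor
  · intro h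
    constructor
    · intro i hi
      have := @h (e.symm (Sum.inl i)) (by simpa [blob] using hi)
      simpa [blob] using this
    · intro p hp
      have := @h (e.symm (Sum.inr p)) (by simpa [blob] using hp)
      simpa [blob] using this
  · rintro ⟨h1, h2⟩ x hx
    simp only [blob, Finset.mem_filter, Finset.mem_univ, true_and] at hx ⊢
    cases hex : e x with
    | inl i => rw [hex] at hx; exact h1 hx
    | inr p => rw [hex] at hx; exact h2 p hx

theorem hasMono_step {m k a b r s N : ℕ} (ha3 : 3 ≤ a) (hab : a + b = k)
    (hr : 2 ≤ r) (hN : N = (r - 2) * s + r)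
    (hbig : (k - 1) * (r - 1) < N) (hA : HasMono m a r) (hB : HasMono m b s) :
    HasMono m k N := by
  classical
  intro χ
  -- choice of the popular color of singletons
  have hk : 2 ≤ k := by omega
  haveI : NeZero k := ⟨by omega⟩
  obtain ⟨d, hd⟩ : ∃ d : Fin k, d ≠ χ ∅ := by
    haveI : Nontrivial (Fin k) := Fin.nontrivial_iff_two_le.2 hk
    exact exists_ne _
  obtain ⟨y, -, hy⟩ := Finset.exists_lt_card_fiber_of_mul_lt_card_of_maps_to
    (s := (Finset.univ : Finset (Fin N))) (t := (Finset.univ.erase (χ ∅) : Finset (Fin k)))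
    (f := fun i => if χ {i} = χ ∅ then d else χ {i}) (n := r - 1)
    (by intro i _; by_cases h : χ {i} = χ ∅ <;> simp [h, hd])
    (by simpa [Finset.card_erase_of_mem] using hbig)
  obtain ⟨A, hsub, hAc⟩ : ∃ A : Finset (Fin k), {χ ∅, χ Finset.univ, y} ⊆ A ∧ A.card = a := by
    have h3 : ({χ ∅, χ Finset.univ, y} : Finset (Fin k)).card ≤ 3 := Finset.card_le_three
    exact Finset.exists_superset_card_eq (by omega) (by rw [Fintype.card_fin]; omega)
  obtain ⟨X, hX, hXc⟩ := Finset.exists_subset_card_eq (Nat.le_of_pred_lt hy)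
  have hXA : ∀ x ∈ X, χ {x} ∈ A := by
    intro x hx
    have := (Finset.mem_filter.1 (hX hx)).2
    by_cases h : χ {x} = χ ∅
    · rw [h]; exact hsub (by simp)
    · rw [if_neg h] at this
      rw [this]; exact hsub (by simp)
  have e1 : {x // x ∈ X} ≃ Fin r := X.equivFinOfCardEq hXc
  have e2 : {x // ¬ x ∈ X} ≃ Fin (r - 2) × Fin s := Fintype.equivOfCardEq (by
    rw [Fintype.card_subtype_compl]
    simp [hXc, hN])
  obtain ⟨e, he⟩ : ∃ e : Fin N ≃ Fin r ⊕ (Fin (r - 2) × Fin s),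
      ∀ i, χ {e.symm (Sum.inl i)} ∈ A := by
    refine ⟨(Equiv.sumCompl (fun x => x ∈ X)).symm.trans (Equiv.sumCongr e1 e2), fun i => ?_⟩
    apply hXA
    simp
  by_cases hblue : ∃ S : Finset (Fin r), (2 ≤ S.card ∧ S.card < r) ∧ ∀ T, χ (blob e S T) ∉ A
  · obtain ⟨S, ⟨h2, hlt⟩, hS⟩ := hblue
    refine hasMono_transfer hB χ Aᶜ (by rw [Finset.card_compl, Fintype.card_fin]; omega)
      (blob e S) ?_ (fun T => by simpa using hS T)
    intro T T'
    rw [blob_subset]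
    constructor
    · intro h
      refine ⟨subset_rfl, fun p hp => ?_⟩
      rcases hp with hp | hp
      · exact Or.inl hp
      · exact Or.inr ⟨hp.1, h hp.2⟩
    · rintro ⟨-, h⟩ q hq
      have := h (⟨S.card - 2, by omega⟩, q) (Or.inr ⟨by simp only; omega, hq⟩)
      rcases this with h | h
      · simp only at h; omega
      · exact h.2
  · push Not at hblue
    have key : ∀ S : Finset (Fin r), ∃ T, χ (blob e S T) ∈ A := by
      intro S
      have hcard : S.card ≤ r := by simpa using S.card_le_univ
      by_cases h0 : S.card = 0
      · refine ⟨∅, ?_⟩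
        have : blob e S ∅ = ∅ := by
          rw [Finset.card_eq_zero] at h0
          subst h0
          ext x
          cases hx : e x <;> simp [blob, hx]
        rw [this]; exact hsub (by simp)
      by_cases h1 : S.card = 1
      · refine ⟨∅, ?_⟩
        obtain ⟨i, rfl⟩ := Finset.card_eq_one.1 h1
        have : blob e {i} ∅ = {e.symm (Sum.inl i)} := by
          ext x
          rw [Finset.mem_singleton, Equiv.eq_symm_apply]
          cases hx : e x <;> simp [blob, hx]
        rw [this]; exact he i
      by_cases hr' : S.card = r
      · refine ⟨∅, ?_⟩
        have : blob e S ∅ = Finset.univ := by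
          have hS : S = Finset.univ := by
            rw [← Finset.card_eq_iff_eq_univ, hr', Fintype.card_fin]
          subst hS
          ext x
          cases hx : e x with
          | inl i => simp [blob, hx]
          | inr p =>
            have := p.1.2
            simp [blob, hx]
            omega
        rw [this]; exact hsub (by simp)
      exact hblue S ⟨by omega, by omega⟩
    choose T hT using key
    refine hasMono_transfer hA χ A hAc (fun S => blob e S (T S)) ?_ hT
    intro S S'
    simp only [blob_subset]
    constructor
    · intro h
      refine ⟨h, fun p hp => ?_⟩
      rcases h.eq_or_ssubset with rfl | h'
      · exact hp
      · have := Finset.card_lt_card h'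
        left
        rcases hp with hp | hp
        · omega
        · have := hp.1; omega
    · exact fun h => h.1

theorem stmt10 (k m : ℕ) (hk : 6 ≤ k) (hm : 2 ≤ m)
    (R : ℕ → ℕ)
    (hR : ∀ j : ℕ, 1 ≤ j →
      IsLeast {N : ℕ | 0 < N ∧ ∀ χ : Finset (Fin N) → Fin j,
          ∃ f : Finset (Fin m) → Finset (Fin N),
            (∀ S T : Finset (Fin m), S ⊆ T ↔ f S ⊆ f T) ∧
            ∃ c : Fin j, ∀ S, χ (f S) = c}
        (R j)) :
    (R k : ℤ) ≤ ((R (k / 2) : ℤ) - 2) * (R ((k + 1) / 2) : ℤ) + (R (k / 2) : ℤ) := by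
  have hA : HasMono m (k / 2) (R (k / 2)) := (hR (k / 2) (by omega)).1.2
  have hB : HasMono m ((k + 1) / 2) (R ((k + 1) / 2)) := (hR ((k + 1) / 2) (by omega)).1.2
  have lA := hasMono_lower _ _ _ hm hA
  have lB := hasMono_lower _ _ _ hm hB
  have hmin := (hR k (by omega)).2
  generalize R (k / 2) = r at *
  generalize R ((k + 1) / 2) = s at *
  have hr : k ≤ r + 1 := by omega
  have hs : k ≤ s := by omega
  have hbig : (k - 1) * (r - 1) < (r - 2) * s + r := by
    obtain ⟨q, rfl⟩ : ∃ q, r = q + 2 := ⟨r - 2, by omega⟩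
    obtain ⟨l, rfl⟩ : ∃ l, k = l + 1 := ⟨k - 1, by omega⟩
    have : q * (l + 1) ≤ q * s := Nat.mul_le_mul_left _ hs
    have e1 : l + 1 - 1 = l := by omega
    have e2 : q + 2 - 1 = q + 1 := by omega
    have e3 : q + 2 - 2 = q := by omega
    rw [e1, e2, e3]
    nlinarith
  have step : HasMono m k ((r - 2) * s + r) :=
    hasMono_step (by omega) (by omega) (by omega) rfl hbig hA hB
  have hle : R k ≤ (r - 2) * s + r := hmin ⟨by omega, step⟩
  have : ((r - 2 : ℕ) : ℤ) = (r : ℤ) - 2 := by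
    rw [Nat.cast_sub (by omega)]; rfl
  rw [← this]
  exact_mod_cast hle
end

section
/- Let k ≥ 1 and r ≥ 2 be integers and let N = 3kr − 2r − k + 1. Then for every function χ from the subsets of [N] to {1,…,k} there exist r+2 pairwise distinct subsets X, Y_1,…,Y_r, Z of [N], all with the same χ-value, such that X ⊆ Y_i ⊆ Z for every i and such that for all i ≠ j neither Y_i ⊆ Y_j nor Y_j ⊆ Y_i. (That is, R^♯_k(𝓑 | ◊_r) ≤ 3kr − 2r − k + 1.) -/
/-- The initial segment of size `i` of the maximal chain coded by `σ`. -/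
def chainSet {n : ℕ} (σ : Equiv.Perm (Fin n)) (i : ℕ) : Finset (Fin n) :=
  Finset.univ.filter (fun x => (σ x).val < i)

/-- rotation of positions in `[a, b)` by `j`. -/
def rotFun (a b j p : ℕ) : ℕ := if a ≤ p ∧ p < b then a + (p - a + j) % (b - a) else p

theorem rotFun_lt {a b j p n : ℕ} (hb : b ≤ n) (hp : p < n) : rotFun a b j p < n := by
  unfold rotFun
  split_ifs with h
  · have := Nat.mod_lt (p - a + j) (show b - a > 0 by omega)
    omega
  · exact hp

theorem rotFun_inj {a b j p q : ℕ} (h : rotFun a b j p = rotFun a b j q) : p = q := by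
  unfold rotFun at h
  split_ifs at h with h1 h2 h2
  · have h3 : (p - a + j) % (b - a) = (q - a + j) % (b - a) := by omega
    have h4 : (p - a) ≡ (q - a) [MOD (b - a)] := Nat.ModEq.add_right_cancel' j h3
    have h5 := Nat.ModEq.eq_of_lt_of_lt h4 (by omega) (by omega)
    omega
  · have := Nat.mod_lt (p - a + j) (show b - a > 0 by omega)
    omega
  · have := Nat.mod_lt (q - a + j) (show b - a > 0 by omega)
    omega
  · exact h

theorem rotFun_low {a b j p i : ℕ} (hi : i ≤ a ∨ b ≤ i) : rotFun a b j p < i ↔ p < i := by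
  unfold rotFun
  split_ifs with h
  · have := Nat.mod_lt (p - a + j) (show b - a > 0 by omega)
    omega
  · rfl

noncomputable def rot (n a b j : ℕ) (hb : b ≤ n) : Equiv.Perm (Fin n) :=
  Equiv.ofBijective (fun p => ⟨rotFun a b j p.val, rotFun_lt hb p.isLt⟩)
    (Finite.injective_iff_bijective.mp (by
      intro p q h
      exact Fin.ext (rotFun_inj (Fin.mk.inj_iff.mp h))))

theorem rot_val {n a b j : ℕ} (hb : b ≤ n) (p : Fin n) :
    (rot n a b j hb p).val = rotFun a b j p.val := rfl

theorem mem_chainSet {n : ℕ} (σ : Equiv.Perm (Fin n)) (i : ℕ) (x : Fin n) :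
    x ∈ chainSet σ i ↔ (σ x).val < i := by simp [chainSet]

theorem card_chainSet {n : ℕ} (σ : Equiv.Perm (Fin n)) (i : ℕ) (hi : i ≤ n) :
    (chainSet σ i).card = i := by
  have h : (chainSet σ i).map σ.toEmbedding = Finset.univ.filter (fun x : Fin n => x.val < i) := by
    ext x
    simp only [Finset.mem_map_equiv, mem_chainSet, Finset.mem_filter, Finset.mem_univ, true_and,
      Equiv.apply_symm_apply]
  rw [← Finset.card_map σ.toEmbedding, h, Fin.card_filter_val_lt]
  omega

theorem chainSet_mono {n : ℕ} (σ : Equiv.Perm (Fin n)) {i j : ℕ} (h : i ≤ j) :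
    chainSet σ i ⊆ chainSet σ j := by
  intro x
  rw [mem_chainSet, mem_chainSet]
  omega

theorem chainSet_rot {n a b j : ℕ} (hb : b ≤ n) (σ : Equiv.Perm (Fin n)) {i : ℕ}
    (hi : i ≤ a ∨ b ≤ i) : chainSet (rot n a b j hb * σ) i = chainSet σ i := by
  ext x
  rw [mem_chainSet, mem_chainSet, Equiv.Perm.mul_apply, rot_val, rotFun_low hi]

theorem rot_aux {m l j j' : ℕ} (hl : 0 < l) (hlm : l < m) (hj : j < m) (hj' : j' < m)
    (h : ∀ u < m, (u + j) % m < l ↔ (u + j') % m < l) : j = j' := by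
  have key : ∀ u < m, ∀ j < m, (u + j) % m = if u + j < m then u + j else u + j - m := by
    intro u hu j hj
    split_ifs with h
    · exact Nat.mod_eq_of_lt h
    · rw [Nat.mod_eq_sub_mod (by omega), Nat.mod_eq_of_lt (by omega)]
  -- `u` is the position sent to `0`, `v` the position sent to `m - 1`
  obtain ⟨u, hu, hu0⟩ : ∃ u < m, (u + j = m ∨ u + j = 0) := by
    rcases Nat.eq_zero_or_pos j with h0 | h0
    · exact ⟨0, by omega, by omega⟩
    · exact ⟨m - j, by omega, by omega⟩
  obtain ⟨v, hv, hv0⟩ : ∃ v < m, (v + 1 = u ∨ (u = 0 ∧ v = m - 1)) := by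
    rcases Nat.eq_zero_or_pos u with h0 | h0
    · exact ⟨m - 1, by omega, by omega⟩
    · exact ⟨u - 1, by omega, by omega⟩
  have h1 := h u hu
  have h2 := h v hv
  rw [key u hu j hj, key u hu j' hj'] at h1
  rw [key v hv j hj, key v hv j' hj'] at h2
  split_ifs at h1 h2 <;> omega

theorem chainSet_rot_inj {n a b j j' i : ℕ} (hb : b ≤ n) (σ : Equiv.Perm (Fin n))
    (hai : a < i) (hib : i < b) (hj : j < b - a) (hj' : j' < b - a)
    (h : chainSet (rot n a b j hb * σ) i = chainSet (rot n a b j' hb * σ) i) : j = j' := by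
  refine rot_aux (m := b - a) (l := i - a) (by omega) (by omega) hj hj' ?_
  intro u hu
  have h1 := Finset.ext_iff.mp h (σ.symm ⟨a + u, by omega⟩)
  rw [mem_chainSet, mem_chainSet, Equiv.Perm.mul_apply, Equiv.Perm.mul_apply, rot_val, rot_val,
    Equiv.apply_symm_apply] at h1
  unfold rotFun at h1
  simp only [show a ≤ a + u ∧ a + u < b by omega, and_self, if_true,
    show a + u - a = u by omega] at h1
  omega

/-- The diamond conclusion. -/
def HasDiamond {n k : ℕ} (r : ℕ) (χ : Finset (Fin n) → Fin k) : Prop :=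
  ∃ (X Z : Finset (Fin n)) (Y : Fin r → Finset (Fin n)),
        Function.Injective Y ∧ (∀ i, X ≠ Y i) ∧ (∀ i, Y i ≠ Z) ∧ X ≠ Z ∧
        (∀ i, χ (Y i) = χ X) ∧ χ Z = χ X ∧
        (∀ i, X ⊆ Y i ∧ Y i ⊆ Z) ∧
        ∀ i j, i ≠ j → ¬ Y i ⊆ Y j

theorem level_bound {n k r : ℕ} (χ : Finset (Fin n) → Fin k) (hno : ¬ HasDiamond r χ)
    {a b i : ℕ} (hb : b ≤ n) (hai : a < i) (hib : i < b) (σ : Equiv.Perm (Fin n)) (c : Fin k)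
    (hca : χ (chainSet σ a) = c) (hcb : χ (chainSet σ b) = c) :
    ((Finset.range (b - a)).filter
      (fun j => χ (chainSet (rot n a b j hb * σ) i) = c)).card < r := by
  by_contra hcon
  push Not at hcon
  obtain ⟨T, hT, hTc⟩ := Finset.exists_subset_card_eq hcon
  let e : Fin r ≃ T := (Finset.equivFinOfCardEq hTc).symm
  have hTm : ∀ t : Fin r, (e t).val < b - a ∧
      χ (chainSet (rot n a b (e t).val hb * σ) i) = c := by
    intro t
    have := hT (e t).2
    simpa using this
  have hinj : Function.Injective (fun t : Fin r => chainSet (rot n a b (e t).val hb * σ) i) := by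
    intro s t hst
    exact e.injective (Subtype.ext
      (chainSet_rot_inj hb σ hai hib (hTm s).1 (hTm t).1 hst))
  have hcardY : ∀ t : Fin r, (chainSet (rot n a b (e t).val hb * σ) i).card = i :=
    fun t => card_chainSet _ _ (by omega)
  have hcA := card_chainSet σ a (by omega)
  have hcB := card_chainSet σ b hb
  refine hno ⟨chainSet σ a, chainSet σ b, fun t => chainSet (rot n a b (e t).val hb * σ) i,
    hinj, ?_, ?_, ?_, ?_, ?_, ?_, ?_⟩
  · intro t h
    have := hcardY t
    simp only at h
    rw [← h] at this
    omega
  · intro t h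
    have := hcardY t
    simp only at h
    rw [h] at this
    omega
  · intro h
    rw [h] at hcA
    omega
  · intro t
    rw [hca]
    exact (hTm t).2
  · rw [hca, hcb]
  · intro t
    constructor
    · rw [← chainSet_rot (j := (e t).val) hb σ (i := a) (Or.inl le_rfl)]
      exact chainSet_mono _ hai.le
    · rw [← chainSet_rot (j := (e t).val) hb σ (i := b) (Or.inr le_rfl)]
      exact chainSet_mono _ hib.le
  · intro s t hst hsub
    exact hst (hinj (Finset.eq_of_subset_of_card_le hsub (by rw [hcardY, hcardY])))

/-- levels of the chain with colour `c` -/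
def lev {n k : ℕ} (χ : Finset (Fin n) → Fin k) (c : Fin k) (σ : Equiv.Perm (Fin n)) : Finset ℕ :=
  (Finset.range (n + 1)).filter (fun i => χ (chainSet σ i) = c)

theorem mem_lev {n k : ℕ} {χ : Finset (Fin n) → Fin k} {c : Fin k} {σ : Equiv.Perm (Fin n)}
    {i : ℕ} : i ∈ lev χ c σ ↔ i ≤ n ∧ χ (chainSet σ i) = c := by
  simp [lev, Nat.lt_succ_iff]

/-- least and greatest level -/
noncomputable def key {n k : ℕ} (χ : Finset (Fin n) → Fin k) (c : Fin k)
    (σ : Equiv.Perm (Fin n)) : ℕ × ℕ :=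
  (sInf (lev χ c σ : Set ℕ), (lev χ c σ).sup id)

theorem key_eq_iff {n k : ℕ} {χ : Finset (Fin n) → Fin k} {c : Fin k} {σ : Equiv.Perm (Fin n)}
    {a b : ℕ} (hab : a < b) :
    key χ c σ = (a, b) ↔ a ∈ lev χ c σ ∧ b ∈ lev χ c σ ∧ ∀ i ∈ lev χ c σ, a ≤ i ∧ i ≤ b := by
  unfold key
  rw [Prod.mk.injEq]
  constructor
  · rintro ⟨h1, h2⟩
    have hne : (lev χ c σ).Nonempty := by
      by_contra h
      rw [Finset.not_nonempty_iff_eq_empty] at h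
      rw [h] at h2
      simp at h2
      omega
    refine ⟨?_, ?_, ?_⟩
    · have := Nat.sInf_mem (s := (lev χ c σ : Set ℕ)) hne
      rw [h1] at this
      exact this
    · obtain ⟨i, hi, hi2⟩ := Finset.exists_mem_eq_sup _ hne id
      rw [← h2, hi2]
      exact hi
    · intro i hi
      exact ⟨h1 ▸ Nat.sInf_le hi, h2 ▸ Finset.le_sup (f := id) hi⟩
  · rintro ⟨h1, h2, h3⟩
    constructor
    · apply le_antisymm (Nat.sInf_le h1)
      exact le_csInf ⟨a, h1⟩ (fun i hi => (h3 i hi).1)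
    · apply le_antisymm
      · exact Finset.sup_le (fun i hi => (h3 i hi).2)
      · exact Finset.le_sup (f := id) h2

theorem key_rot {n k : ℕ} {χ : Finset (Fin n) → Fin k} {c : Fin k} {σ : Equiv.Perm (Fin n)}
    {a b : ℕ} (hab : a < b) (hb : b ≤ n) (j : ℕ) :
    key χ c (rot n a b j hb * σ) = (a, b) ↔ key χ c σ = (a, b) := by
  have hout : ∀ i, (i ≤ a ∨ b ≤ i) → (i ∈ lev χ c (rot n a b j hb * σ) ↔ i ∈ lev χ c σ) := by
    intro i hi
    rw [mem_lev, mem_lev, chainSet_rot hb σ hi]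
  rw [key_eq_iff hab, key_eq_iff hab, hout a (Or.inl le_rfl), hout b (Or.inr le_rfl)]
  refine and_congr_right fun _ => and_congr_right fun _ => ?_
  constructor
  · intro h i hi
    by_contra hc
    exact hc (h i ((hout i (by omega)).2 hi))
  · intro h i hi
    by_contra hc
    exact hc (h i ((hout i (by omega)).1 hi))

theorem orbit_bound {n k r : ℕ} (χ : Finset (Fin n) → Fin k) (hno : ¬ HasDiamond r χ)
    {a b : ℕ} (hb : b ≤ n) (hab : a < b) (hr : 2 ≤ r) (σ : Equiv.Perm (Fin n)) (c : Fin k)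
    (hk : key χ c σ = (a, b)) :
    ∑ j ∈ Finset.range (b - a), (lev χ c (rot n a b j hb * σ)).card < (b - a) * (r + 1) := by
  classical
  have hs := (key_eq_iff hab).1 hk
  have h1 : ∀ j, (lev χ c (rot n a b j hb * σ)).card ≤
      2 + ∑ i ∈ Finset.Ioo a b, if χ (chainSet (rot n a b j hb * σ) i) = c then 1 else 0 := by
    intro j
    have hj := (key_eq_iff hab).1 ((key_rot hab hb j).2 hk)
    rw [← Finset.card_filter]
    have hsub : lev χ c (rot n a b j hb * σ) ⊆ {a, b} ∪ (Finset.Ioo a b).filter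
        (fun i => χ (chainSet (rot n a b j hb * σ) i) = c) := by
      intro i hi
      have h2 := hj.2.2 i hi
      have h3 := (mem_lev.1 hi).2
      simp only [Finset.mem_union, Finset.mem_insert, Finset.mem_singleton, Finset.mem_filter,
        Finset.mem_Ioo]
      by_cases ha : i = a
      · exact Or.inl (Or.inl ha)
      by_cases hb' : i = b
      · exact Or.inl (Or.inr hb')
      exact Or.inr ⟨by omega, h3⟩
    refine (Finset.card_le_card hsub).trans ((Finset.card_union_le _ _).trans ?_)
    exact Nat.add_le_add_right Finset.card_le_two _
  have h2 : ∑ i ∈ Finset.Ioo a b, ∑ j ∈ Finset.range (b - a),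
      (if χ (chainSet (rot n a b j hb * σ) i) = c then 1 else 0) ≤ (b - a - 1) * (r - 1) := by
    refine (Finset.sum_le_card_nsmul _ _ (r - 1) ?_).trans ?_
    · intro i hi
      rw [Finset.mem_Ioo] at hi
      rw [← Finset.card_filter]
      have := level_bound χ hno hb hi.1 hi.2 σ c (mem_lev.1 hs.1).2 (mem_lev.1 hs.2.1).2
      omega
    · simp
  have h3 := Finset.sum_le_sum (fun j (_ : j ∈ Finset.range (b - a)) => h1 j)
  rw [Finset.sum_add_distrib, Finset.sum_comm] at h3
  simp only [Finset.sum_const, Finset.card_range, smul_eq_mul] at h3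
  obtain ⟨m, hm⟩ : ∃ m, b - a = m + 1 := ⟨b - a - 1, by omega⟩
  obtain ⟨s, rfl⟩ : ∃ s, r = s + 2 := ⟨r - 2, by omega⟩
  have h4 := h3.trans (Nat.add_le_add_left h2 _)
  refine lt_of_le_of_lt h4 ?_
  rw [hm, show m + 1 - 1 = m by omega, show s + 2 - 1 = s + 1 by omega]
  nlinarith

theorem color_bound {n k r : ℕ} (χ : Finset (Fin n) → Fin k) (hno : ¬ HasDiamond r χ)
    (hr : 2 ≤ r) (c : Fin k) :
    ∑ σ : Equiv.Perm (Fin n), (lev χ c σ).card < ∑ _σ : Equiv.Perm (Fin n), (r + 1) := by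
  classical
  have hmaps : ∀ σ ∈ (Finset.univ : Finset (Equiv.Perm (Fin n))),
      key χ c σ ∈ Finset.univ.image (key χ c) := fun σ _ =>
    Finset.mem_image_of_mem _ (Finset.mem_univ _)
  rw [← Finset.sum_fiberwise_of_maps_to hmaps, ← Finset.sum_fiberwise_of_maps_to hmaps]
  apply Finset.sum_lt_sum_of_nonempty (Finset.univ_nonempty.image _)
  rintro ⟨a, b⟩ hab
  obtain ⟨σ₀, -, hσ₀⟩ := Finset.mem_image.1 hab
  set G := Finset.univ.filter (fun σ => key χ c σ = (a, b)) with hG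
  have hGne : G.Nonempty := ⟨σ₀, by simp [hG, hσ₀]⟩
  by_cases hlt : a < b
  · have hs := (key_eq_iff hlt).1 hσ₀
    have hb : b ≤ n := (mem_lev.1 hs.2.1).1
    have hinv : ∀ j, ∑ σ ∈ G, (lev χ c (rot n a b j hb * σ)).card =
        ∑ σ ∈ G, (lev χ c σ).card := by
      intro j
      refine Finset.sum_equiv (Equiv.mulLeft (rot n a b j hb)) ?_ ?_
      · intro σ
        simp [hG, key_rot hlt hb j]
      · intro σ _
        rfl
    have h1 : ∑ σ ∈ G, ∑ j ∈ Finset.range (b - a), (lev χ c (rot n a b j hb * σ)).card <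
        ∑ σ ∈ G, (b - a) * (r + 1) := by
      apply Finset.sum_lt_sum_of_nonempty hGne
      intro σ hσ
      exact orbit_bound χ hno hb hlt hr σ c (by simpa [hG] using hσ)
    rw [Finset.sum_comm, Finset.sum_congr rfl (fun j _ => hinv j), Finset.sum_const,
      Finset.card_range, smul_eq_mul, ← Finset.mul_sum] at h1
    exact Nat.lt_of_mul_lt_mul_left h1
  · apply Finset.sum_lt_sum_of_nonempty hGne
    intro σ hσ
    have hk : key χ c σ = (a, b) := by simpa [hG] using hσ
    unfold key at hk
    rw [Prod.mk.injEq] at hk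
    have hsub : lev χ c σ ⊆ {a} := by
      intro i hi
      have h1 : a ≤ i := hk.1 ▸ Nat.sInf_le hi
      have h2 : i ≤ b := hk.2 ▸ Finset.le_sup (f := id) hi
      rw [Finset.mem_singleton]
      omega
    have := Finset.card_le_card hsub
    rw [Finset.card_singleton] at this
    omega

theorem main_diamond {n k r : ℕ} (hr : 2 ≤ r) (hn : k * (r + 1) ≤ n + 1)
    (χ : Finset (Fin n) → Fin k) : HasDiamond r χ := by
  classical
  by_contra hno
  have h1 : ∑ c : Fin k, ∑ σ : Equiv.Perm (Fin n), (lev χ c σ).card <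
      ∑ _c : Fin k, ∑ _σ : Equiv.Perm (Fin n), (r + 1) :=
    Finset.sum_lt_sum_of_nonempty ⟨χ ∅, Finset.mem_univ _⟩
      (fun c _ => color_bound χ hno hr c)
  rw [Finset.sum_comm] at h1
  have h2 : ∀ σ : Equiv.Perm (Fin n), ∑ c : Fin k, (lev χ c σ).card = n + 1 := by
    intro σ
    have := Finset.card_eq_sum_card_fiberwise (s := Finset.range (n + 1))
      (t := (Finset.univ : Finset (Fin k))) (f := fun i => χ (chainSet σ i))
      (fun _ _ => Finset.mem_coe.2 (Finset.mem_univ _))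
    rw [Finset.card_range] at this
    exact this.symm
  rw [Finset.sum_congr rfl (fun σ _ => h2 σ)] at h1
  simp only [Finset.sum_const, smul_eq_mul, Finset.card_univ, Fintype.card_fin] at h1
  have h3 : Fintype.card (Equiv.Perm (Fin n)) * (k * (r + 1)) ≤
      Fintype.card (Equiv.Perm (Fin n)) * (n + 1) := Nat.mul_le_mul_left _ hn
  have h4 : k * (Fintype.card (Equiv.Perm (Fin n)) * (r + 1)) =
      Fintype.card (Equiv.Perm (Fin n)) * (k * (r + 1)) := by ring
  omega

theorem stmt12 (k r : ℕ) (hk : 1 ≤ k) (hr : 2 ≤ r)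
    (χ : Finset (Fin (3 * k * r - 2 * r - k + 1)) → Fin k) :
    ∃ (X Z : Finset (Fin (3 * k * r - 2 * r - k + 1)))
      (Y : Fin r → Finset (Fin (3 * k * r - 2 * r - k + 1))),
        Function.Injective Y ∧ (∀ i, X ≠ Y i) ∧ (∀ i, Y i ≠ Z) ∧ X ≠ Z ∧
        (∀ i, χ (Y i) = χ X) ∧ χ Z = χ X ∧
        (∀ i, X ⊆ Y i ∧ Y i ⊆ Z) ∧
        ∀ i j, i ≠ j → ¬ Y i ⊆ Y j := by
  refine main_diamond hr ?_ χ
  obtain ⟨l, rfl⟩ : ∃ l, k = l + 1 := ⟨k - 1, by omega⟩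
  obtain ⟨s, rfl⟩ : ∃ s, r = s + 2 := ⟨r - 2, by omega⟩
  have h1 : 3 * (l + 1) * (s + 2) = 3 * (l * s) + 6 * l + 3 * s + 6 := by ring
  have h2 : (l + 1) * (s + 2 + 1) = l * s + 3 * l + s + 3 := by ring
  rw [h1, h2]
  omega
end
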